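/- arXiv:2005.02232 — 7 statements merged into one kernel-verified Lean document; each statement's English description precedes it below -/
import Mathlib

section
/- Let C > 0. Let m₁, m₂ be Borel probability measures on ℝ^d with finite first moments and ∫|x| dm₂(x) ≤ C, and let g₁, g₂ : ℝ^d → ℝ^{d'} be Borel maps that are C-Lipschitz and satisfy |gᵢ(x)| ≤ C(1+|x|) for all x (i = 1,2). Then d₁(g₁♯m₁, g₂♯m₂) ≤ (1+C)·‖g₁ − g₂‖_{𝒢,1} + C·d₁(m₁, m₂), where ‖g₁ − g₂‖_{𝒢,1} := sup_{x∈ℝ^d} |g₁(x) − g₂(x)|/(1+|x|). -/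
open MeasureTheory ENNReal

/-- The Kantorovich–Rubinstein distance: the supremum of `∫ φ dμ − ∫ φ dν` over
1-Lipschitz functions `φ`. -/
noncomputable def d1 {X : Type*} [MeasurableSpace X] [NormedAddCommGroup X]
    (μ ν : Measure X) : ℝ :=
  sSup {r : ℝ | ∃ φ : X → ℝ, LipschitzWith 1 φ ∧ r = ∫ x, φ x ∂μ - ∫ x, φ x ∂ν}

section Helpers

variable {X : Type*} [MeasurableSpace X] [NormedAddCommGroup X] [OpensMeasurableSpace X]

/-- A Lipschitz function is integrable against a finite measure with finite first moment. -/
theorem LipschitzWith.integrable_of_integrable_norm {μ : Measure X} [IsFiniteMeasure μ]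
    (hμ : Integrable (fun x => ‖x‖) μ) {K : NNReal} {φ : X → ℝ} (hφ : LipschitzWith K φ) :
    Integrable φ μ := by
  refine ((integrable_const ‖φ 0‖).add (hμ.const_mul (K : ℝ))).mono'
    hφ.continuous.aestronglyMeasurable (Filter.Eventually.of_forall fun x => ?_)
  have h := hφ.dist_le_mul x 0
  rw [dist_eq_norm, dist_zero_right] at h
  have h' := norm_add_le (φ x - φ 0) (φ 0)
  rw [sub_add_cancel] at h'
  simp only [Pi.add_apply]
  linarith

/-- The set whose supremum defines `d1` is bounded above for probability measures with finite
first moments. -/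
theorem bddAbove_d1_set {μ ν : Measure X} [IsProbabilityMeasure μ] [IsProbabilityMeasure ν]
    (hμ : Integrable (fun x => ‖x‖) μ) (hν : Integrable (fun x => ‖x‖) ν) :
    BddAbove {r : ℝ | ∃ φ : X → ℝ, LipschitzWith 1 φ ∧ r = ∫ x, φ x ∂μ - ∫ x, φ x ∂ν} := by
  refine ⟨∫ x, ‖x‖ ∂μ + ∫ x, ‖x‖ ∂ν, ?_⟩
  rintro r ⟨φ, hφ, rfl⟩
  have hb (x : X) : |φ x - φ 0| ≤ ‖x‖ := by
    simpa [Real.dist_eq] using hφ.dist_le_mul x 0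
  have hiμ := hφ.integrable_of_integrable_norm hμ
  have hiν := hφ.integrable_of_integrable_norm hν
  have h1 : ∫ x, φ x ∂μ ≤ ∫ x, (φ 0 + ‖x‖) ∂μ :=
    integral_mono hiμ ((integrable_const _).add hμ) fun x => by
      have := (abs_le.mp (hb x)).2
      simp only
      linarith
  have h2 : ∫ x, (φ 0 - ‖x‖) ∂ν ≤ ∫ x, φ x ∂ν :=
    integral_mono ((integrable_const _).sub hν) hiν fun x => by
      have := (abs_le.mp (hb x)).1
      simp only
      linarith
  rw [integral_add (integrable_const _) hμ] at h1
  rw [integral_sub (integrable_const _) hν] at h2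
  simp only [integral_const, probReal_univ, one_smul] at h1 h2
  linarith

/-- Testing `K`-Lipschitz functions against `d1`. -/
theorem integral_sub_le_mul_d1 {μ ν : Measure X} [IsProbabilityMeasure μ]
    [IsProbabilityMeasure ν] (hμ : Integrable (fun x => ‖x‖) μ)
    (hν : Integrable (fun x => ‖x‖) ν) {K : NNReal} (hK : 0 < K) {φ : X → ℝ}
    (hφ : LipschitzWith K φ) :
    ∫ x, φ x ∂μ - ∫ x, φ x ∂ν ≤ K * d1 μ ν := by
  have hK' : (0 : ℝ) < K := hK
  have hψ : LipschitzWith 1 fun x => (K : ℝ)⁻¹ * φ x := by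
    refine LipschitzWith.of_dist_le_mul fun x y => ?_
    have h := hφ.dist_le_mul x y
    rw [Real.dist_eq] at h ⊢
    rw [← mul_sub, abs_mul, abs_of_pos (inv_pos.mpr hK'), inv_mul_le_iff₀ hK']
    simpa using h
  have h := le_csSup (bddAbove_d1_set hμ hν) ⟨_, hψ, rfl⟩
  rw [integral_const_mul, integral_const_mul, ← mul_sub, inv_mul_le_iff₀ hK'] at h
  exact h

end Helpers

/-- Let `C > 0`, let `m₁, m₂` be Borel probability measures on `ℝ^d`
with finite first moments and `∫|x| dm₂ ≤ C`, and let `g₁, g₂ : ℝ^d → ℝ^{d'}` be Borel,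
`C`-Lipschitz, with `|gᵢ(x)| ≤ C(1+|x|)`.  Then
`d₁(g₁♯m₁, g₂♯m₂) ≤ (1+C)·‖g₁−g₂‖_{𝒢,1} + C·d₁(m₁,m₂)`,
where `‖g₁−g₂‖_{𝒢,1} = sup_x |g₁(x)−g₂(x)|/(1+|x|)`. -/
theorem d1_pushforward_estimate {d d' : ℕ} (C : ℝ) (hC : 0 < C)
    (m₁ m₂ : Measure (EuclideanSpace ℝ (Fin d)))
    [IsProbabilityMeasure m₁] [IsProbabilityMeasure m₂]
    (h₁ : ∫⁻ x, (‖x‖₊ : ℝ≥0∞) ∂m₁ < ⊤)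
    (h₂ : ∫⁻ x, (‖x‖₊ : ℝ≥0∞) ∂m₂ ≤ ENNReal.ofReal C)
    (g₁ g₂ : EuclideanSpace ℝ (Fin d) → EuclideanSpace ℝ (Fin d'))
    (hg₁meas : Measurable g₁) (hg₂meas : Measurable g₂)
    (hg₁lip : LipschitzWith C.toNNReal g₁) (hg₂lip : LipschitzWith C.toNNReal g₂)
    (hg₁ : ∀ x, ‖g₁ x‖ ≤ C * (1 + ‖x‖)) (hg₂ : ∀ x, ‖g₂ x‖ ≤ C * (1 + ‖x‖)) :
    d1 (m₁.map g₁) (m₂.map g₂) ≤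
      (1 + C) * (⨆ x : EuclideanSpace ℝ (Fin d), ‖g₁ x - g₂ x‖ / (1 + ‖x‖))
        + C * d1 m₁ m₂ := by
  have hi₁ : Integrable (fun x => ‖x‖) m₁ :=
    Integrable.norm (f := fun x => x) ⟨measurable_id.aestronglyMeasurable, h₁⟩
  have hi₂ : Integrable (fun x => ‖x‖) m₂ :=
    Integrable.norm (f := fun x => x)
      ⟨measurable_id.aestronglyMeasurable, h₂.trans_lt ENNReal.ofReal_lt_top⟩
  have hmoment : ∫ x, ‖x‖ ∂m₂ ≤ C := by
    rw [integral_norm_eq_lintegral_enorm (f := fun x => x) measurable_id.aestronglyMeasurable]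
    exact ENNReal.toReal_le_of_le_ofReal hC.le h₂
  have hbdd : BddAbove (Set.range fun x => ‖g₁ x - g₂ x‖ / (1 + ‖x‖)) := by
    refine ⟨2 * C, ?_⟩
    rintro _ ⟨x, rfl⟩
    have hx : 0 < 1 + ‖x‖ := by positivity
    rw [div_le_iff₀ hx]
    linarith [norm_sub_le (g₁ x) (g₂ x), hg₁ x, hg₂ x]
  set S := ⨆ x : EuclideanSpace ℝ (Fin d), ‖g₁ x - g₂ x‖ / (1 + ‖x‖)
  have hS0 : 0 ≤ S := Real.iSup_nonneg fun x => by positivity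
  have hS (x) : ‖g₁ x - g₂ x‖ ≤ S * (1 + ‖x‖) := by
    have hx : 0 < 1 + ‖x‖ := by positivity
    exact (div_le_iff₀ hx).mp (le_ciSup hbdd x)
  refine csSup_le ⟨_, fun _ => 0, LipschitzWith.const' 0, rfl⟩ ?_
  rintro r ⟨φ, hφ, rfl⟩
  rw [integral_map hg₁meas.aemeasurable hφ.continuous.aestronglyMeasurable,
    integral_map hg₂meas.aemeasurable hφ.continuous.aestronglyMeasurable]
  have hl₁ : LipschitzWith C.toNNReal fun x => φ (g₁ x) := by
    simpa [Function.comp_def] using hφ.comp hg₁lip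
  have hl₂ : LipschitzWith C.toNNReal fun x => φ (g₂ x) := by
    simpa [Function.comp_def] using hφ.comp hg₂lip
  have hmeasure := integral_sub_le_mul_d1 hi₁ hi₂ (Real.toNNReal_pos.mpr hC) hl₁
  rw [Real.coe_toNNReal C hC.le] at hmeasure
  have hmap : ∫ x, φ (g₁ x) ∂m₂ - ∫ x, φ (g₂ x) ∂m₂ ≤ ∫ x, S * (1 + ‖x‖) ∂m₂ := by
    have hj₁ := hl₁.integrable_of_integrable_norm hi₂
    have hj₂ := hl₂.integrable_of_integrable_norm hi₂
    rw [← integral_sub hj₁ hj₂]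
    refine integral_mono (hj₁.sub hj₂) (((integrable_const _).add hi₂).const_mul S) fun x => ?_
    have h := hφ.dist_le_mul (g₁ x) (g₂ x)
    rw [Real.dist_eq, dist_eq_norm, NNReal.coe_one, one_mul] at h
    exact (le_abs_self _).trans (h.trans (hS x))
  rw [integral_const_mul, integral_add (integrable_const _) hi₂, integral_const,
    probReal_univ, one_smul] at hmap
  nlinarith [mul_le_mul_of_nonneg_left hmoment hS0]
end

section
/- Let R > 0 and let u : ℝ^d → ℝ be a convex function with −R ≤ u(x) ≤ R(1+|x|²) for all x. Then for every x ∈ ℝ^d, the proximal point prox_u(x) satisfies |prox_u(x)|² ≤ (8R+2)(1+|x|²); in particular |prox_u(x)| ≤ √(8R+2)·(1+|x|) for all x. -/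
/-- `p` is the proximal point of `u` at `x`, i.e. `p` minimizes
`y ↦ ½|x−y|² + u(y)` over `ℝ^d`. -/
def IsProx {d : ℕ} (u : EuclideanSpace ℝ (Fin d) → ℝ) (x p : EuclideanSpace ℝ (Fin d)) :
    Prop :=
  ∀ y, (1 / 2) * ‖x - p‖ ^ 2 + u p ≤ (1 / 2) * ‖x - y‖ ^ 2 + u y

/-- Let `R > 0` and let `u : ℝ^d → ℝ` be convex with
`−R ≤ u(x) ≤ R(1+|x|²)` for all `x`.  Then for every `x`, the proximal point
`prox_u(x)` satisfies `|prox_u(x)|² ≤ (8R+2)(1+|x|²)`; in particular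
`|prox_u(x)| ≤ √(8R+2)·(1+|x|)`. -/
theorem prox_growth {d : ℕ} (R : ℝ) (hR : 0 < R)
    (u : EuclideanSpace ℝ (Fin d) → ℝ)
    (hconv : ConvexOn ℝ Set.univ u)
    (hbound : ∀ x, -R ≤ u x ∧ u x ≤ R * (1 + ‖x‖ ^ 2)) :
    ∀ x q, IsProx u x q →
      ‖q‖ ^ 2 ≤ (8 * R + 2) * (1 + ‖x‖ ^ 2) ∧
      ‖q‖ ≤ Real.sqrt (8 * R + 2) * (1 + ‖x‖) := by
  intro x q hq
  have hprox := hq x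
  rw [sub_self, norm_zero] at hprox
  have hlower := (hbound q).1
  have hupper := (hbound x).2
  have htri : ‖q‖ ≤ ‖x‖ + ‖x - q‖ := norm_le_norm_add_norm_sub x q
  have hsq : ‖q‖ ^ 2 ≤ 2 * ‖x‖ ^ 2 + 2 * ‖x - q‖ ^ 2 := by
    nlinarith [norm_nonneg q, sq_nonneg (‖x‖ - ‖x - q‖)]
  have hgrowth : ‖q‖ ^ 2 ≤ (8 * R + 2) * (1 + ‖x‖ ^ 2) := by
    nlinarith [mul_nonneg hR.le (sq_nonneg ‖x‖)]
  refine ⟨hgrowth, abs_le_of_sq_le_sq' ?_ (by positivity) |>.2⟩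
  rw [mul_pow, Real.sq_sqrt (by positivity)]
  refine hgrowth.trans (mul_le_mul_of_nonneg_left ?_ (by positivity))
  nlinarith [norm_nonneg x]
end

section
/- Let R > 0 and let u : ℝ^d → ℝ be a convex function with −R ≤ u(x) ≤ R(1+|x|²) for all x. Then the Moreau envelope V_u is convex and satisfies −C₂(R) ≤ V_u(x) ≤ C₂(R)(1+|x|²) for all x ∈ ℝ^d, where C₂(R) := (R+1)(1+C₁(R)) and C₁(R) := 8R+2. -/
/-- The Moreau envelope of `u`: `V_u(x) = inf_y (½|x−y|² + u(y))`. -/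
noncomputable def moreau {d : ℕ} (u : EuclideanSpace ℝ (Fin d) → ℝ)
    (x : EuclideanSpace ℝ (Fin d)) : ℝ :=
  ⨅ y : EuclideanSpace ℝ (Fin d), (1 / 2) * ‖x - y‖ ^ 2 + u y

theorem bddBelow_range_moreau {d : ℕ} {u : EuclideanSpace ℝ (Fin d) → ℝ} {m : ℝ}
    (hm : ∀ y, m ≤ u y) (x : EuclideanSpace ℝ (Fin d)) :
    BddBelow (Set.range fun y => (1 / 2) * ‖x - y‖ ^ 2 + u y) :=
  ⟨m, by rintro _ ⟨y, rfl⟩; exact le_add_of_nonneg_of_le (by positivity) (hm y)⟩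

theorem le_moreau {d : ℕ} {u : EuclideanSpace ℝ (Fin d) → ℝ} {m : ℝ}
    (hm : ∀ y, m ≤ u y) (x : EuclideanSpace ℝ (Fin d)) : m ≤ moreau u x :=
  le_ciInf fun y => le_add_of_nonneg_of_le (by positivity) (hm y)

theorem moreau_le_self {d : ℕ} {u : EuclideanSpace ℝ (Fin d) → ℝ} {m : ℝ}
    (hm : ∀ y, m ≤ u y) (x : EuclideanSpace ℝ (Fin d)) : moreau u x ≤ u x :=
  (ciInf_le (bddBelow_range_moreau hm x) x).trans_eq (by simp)

theorem convexOn_moreau {d : ℕ} {u : EuclideanSpace ℝ (Fin d) → ℝ} {m : ℝ}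
    (hm : ∀ y, m ≤ u y) (hconv : ConvexOn ℝ Set.univ u) :
    ConvexOn ℝ Set.univ (moreau u) := by
  have hsq : ConvexOn ℝ Set.univ fun z : EuclideanSpace ℝ (Fin d) => ‖z‖ ^ 2 :=
    convexOn_univ_norm.pow (fun _ _ => norm_nonneg _) 2
  refine ⟨convex_univ, fun x₁ _ x₂ _ a b ha hb hab => le_of_forall_pos_le_add fun ε hε => ?_⟩
  obtain ⟨y₁, h₁⟩ := exists_lt_of_ciInf_lt (show moreau u x₁ < moreau u x₁ + ε by linarith)
  obtain ⟨y₂, h₂⟩ := exists_lt_of_ciInf_lt (show moreau u x₂ < moreau u x₂ + ε by linarith)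
  have hle : moreau u (a • x₁ + b • x₂) ≤ _ :=
    ciInf_le (bddBelow_range_moreau hm _) (a • y₁ + b • y₂)
  have hu := hconv.2 (Set.mem_univ y₁) (Set.mem_univ y₂) ha hb hab
  have hn := hsq.2 (Set.mem_univ (x₁ - y₁)) (Set.mem_univ (x₂ - y₂)) ha hb hab
  have hsub : a • x₁ + b • x₂ - (a • y₁ + b • y₂) = a • (x₁ - y₁) + b • (x₂ - y₂) := by
    module
  simp only [smul_eq_mul, hsub] at hle hu hn ⊢
  have hε' : a * ε + b * ε = ε := by rw [← add_mul, hab, one_mul]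
  have e₁ := mul_le_mul_of_nonneg_left h₁.le ha
  have e₂ := mul_le_mul_of_nonneg_left h₂.le hb
  linarith

/-- Let `R > 0` and `u : ℝ^d → ℝ` convex with `−R ≤ u(x) ≤ R(1+|x|²)`.
Then the Moreau envelope `V_u` is convex and satisfies `−C₂(R) ≤ V_u(x) ≤ C₂(R)(1+|x|²)`,
where `C₂(R) = (R+1)(1+C₁(R))` and `C₁(R) = 8R+2`. -/
theorem moreau_in_Q2 {d : ℕ} (R : ℝ) (hR : 0 < R)
    (u : EuclideanSpace ℝ (Fin d) → ℝ)
    (hconv : ConvexOn ℝ Set.univ u)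
    (hbound : ∀ x, -R ≤ u x ∧ u x ≤ R * (1 + ‖x‖ ^ 2)) :
    ConvexOn ℝ Set.univ (moreau u) ∧
    ∀ x, -((R + 1) * (1 + (8 * R + 2))) ≤ moreau u x ∧
      moreau u x ≤ (R + 1) * (1 + (8 * R + 2)) * (1 + ‖x‖ ^ 2) := by
  have hm : ∀ y, -R ≤ u y := fun y => (hbound y).1
  have hC : R ≤ (R + 1) * (1 + (8 * R + 2)) := by nlinarith
  refine ⟨convexOn_moreau hm hconv, fun x => ⟨?_, ?_⟩⟩
  · linarith [le_moreau hm x]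
  · calc moreau u x ≤ u x := moreau_le_self hm x
      _ ≤ R * (1 + ‖x‖ ^ 2) := (hbound x).2
      _ ≤ _ := by gcongr
end

section
/- Let R > 0 and let u, v : ℝ^d → ℝ be convex functions with −R ≤ u(x) ≤ R(1+|x|²) and −R ≤ v(x) ≤ R(1+|x|²) for all x. Then for every x ∈ ℝ^d, |prox_u(x) − prox_v(x)| ≤ C₃(R)·(1+|x|)·(‖u − v‖_{𝒢,2})^{1/2}, where C₃(R) := √(2(1+C₁(R))), C₁(R) := 8R+2, and ‖u−v‖_{𝒢,2} := sup_{x} |u(x)−v(x)|/(1+|x|²). -/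
theorem norm_sub_convex_combination_sq {E : Type*} [NormedAddCommGroup E] [InnerProductSpace ℝ E]
    (x p q : E) (t : ℝ) :
    ‖x - ((1 - t) • p + t • q)‖ ^ 2 =
      (1 - t) * ‖x - p‖ ^ 2 + t * ‖x - q‖ ^ 2 - t * (1 - t) * ‖p - q‖ ^ 2 := by
  have h₁ : x - ((1 - t) • p + t • q) = (1 - t) • (x - p) + t • (x - q) := by module
  have h₂ : p - q = (x - q) - (x - p) := by abel
  rw [h₁, h₂, norm_add_sq_real, norm_sub_sq_real (x - q) (x - p), norm_smul, norm_smul,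
    mul_pow, mul_pow, Real.norm_eq_abs, Real.norm_eq_abs, sq_abs, sq_abs, real_inner_smul_left,
    real_inner_smul_right, real_inner_comm (x - p) (x - q)]
  ring

theorem le_of_forall_one_sub_mul_le {a b : ℝ} (ha : 0 ≤ a)
    (h : ∀ t : ℝ, 0 < t → t < 1 → (1 - t) * a ≤ b) : a ≤ b := by
  by_contra! hab
  have hb : 0 ≤ b := le_trans (by positivity) (h (1 / 2) (by norm_num) (by norm_num))
  have ha' : 0 < a := hb.trans_lt hab
  have key := h ((a - b) / (2 * a)) (div_pos (by linarith) (by linarith))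
    ((div_lt_one (by linarith)).2 (by linarith))
  have hcancel : (1 - (a - b) / (2 * a)) * a = (a + b) / 2 := by
    field_simp
    ring
  linarith

/-- Quadratic growth of the proximal objective away from its minimizer. -/
theorem IsProx.add_sq_le {d : ℕ} {u : EuclideanSpace ℝ (Fin d) → ℝ}
    (hu : ConvexOn ℝ Set.univ u) {x p : EuclideanSpace ℝ (Fin d)} (hp : IsProx u x p)
    (y : EuclideanSpace ℝ (Fin d)) :
    (1 / 2) * ‖x - p‖ ^ 2 + u p + (1 / 2) * ‖p - y‖ ^ 2 ≤ (1 / 2) * ‖x - y‖ ^ 2 + u y := by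
  suffices h : (1 / 2) * ‖p - y‖ ^ 2 ≤
      (1 / 2) * ‖x - y‖ ^ 2 + u y - ((1 / 2) * ‖x - p‖ ^ 2 + u p) by linarith
  refine le_of_forall_one_sub_mul_le (by positivity) fun t ht₀ ht₁ => ?_
  have hmin := hp ((1 - t) • p + t • y)
  have hconv := hu.2 (Set.mem_univ p) (Set.mem_univ y) (sub_nonneg.2 ht₁.le) ht₀.le (by ring)
  rw [norm_sub_convex_combination_sq] at hmin
  simp only [smul_eq_mul] at hconv
  refine le_of_mul_le_mul_left ?_ ht₀
  linarith

theorem IsProx.norm_sq_le {d : ℕ} {u : EuclideanSpace ℝ (Fin d) → ℝ} {R : ℝ}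
    (hu : ConvexOn ℝ Set.univ u) (hbound : ∀ x, -R ≤ u x ∧ u x ≤ R * (1 + ‖x‖ ^ 2))
    {x p : EuclideanSpace ℝ (Fin d)} (hp : IsProx u x p) :
    ‖p‖ ^ 2 ≤ ‖x‖ ^ 2 + 4 * R := by
  have h := hp.add_sq_le hu 0
  have h₀ := (hbound 0).2
  simp only [sub_zero, norm_zero] at h h₀
  linarith [(hbound p).1, sq_nonneg ‖x - p‖]

theorem abs_sub_le_iSup_mul {E : Type*} [NormedAddCommGroup E] {u v : E → ℝ} {R : ℝ}
    (hu : ∀ x, -R ≤ u x ∧ u x ≤ R * (1 + ‖x‖ ^ 2))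
    (hv : ∀ x, -R ≤ v x ∧ v x ≤ R * (1 + ‖x‖ ^ 2)) (hR : 0 ≤ R) (x : E) :
    |u x - v x| ≤ (⨆ z : E, |u z - v z| / (1 + ‖z‖ ^ 2)) * (1 + ‖x‖ ^ 2) := by
  have hbdd : BddAbove (Set.range fun z : E => |u z - v z| / (1 + ‖z‖ ^ 2)) := by
    refine ⟨2 * R, ?_⟩
    rintro _ ⟨z, rfl⟩
    have hz : 0 ≤ R * ‖z‖ ^ 2 := by positivity
    refine (div_le_iff₀ (by positivity)).2 (abs_le.2 ⟨?_, ?_⟩) <;>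
      linarith [(hu z).1, (hu z).2, (hv z).1, (hv z).2]
  exact (div_le_iff₀ (by positivity)).1 (le_ciSup hbdd x)

/-- Let `R > 0` and let `u, v : ℝ^d → ℝ` be convex with
`−R ≤ u(x), v(x) ≤ R(1+|x|²)`.  Then for every `x`,
`|prox_u(x) − prox_v(x)| ≤ C₃(R)·(1+|x|)·‖u−v‖_{𝒢,2}^{1/2}` where
`C₃(R) = √(2(1+C₁(R)))`, `C₁(R) = 8R+2` and
`‖u−v‖_{𝒢,2} = sup_x |u(x)−v(x)|/(1+|x|²)`. -/
theorem prox_stability {d : ℕ} (R : ℝ) (hR : 0 < R)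
    (u v : EuclideanSpace ℝ (Fin d) → ℝ)
    (huconv : ConvexOn ℝ Set.univ u) (hvconv : ConvexOn ℝ Set.univ v)
    (hubound : ∀ x, -R ≤ u x ∧ u x ≤ R * (1 + ‖x‖ ^ 2))
    (hvbound : ∀ x, -R ≤ v x ∧ v x ≤ R * (1 + ‖x‖ ^ 2)) :
    ∀ x p q, IsProx u x p → IsProx v x q →
      ‖p - q‖ ≤ Real.sqrt (2 * (1 + (8 * R + 2))) * (1 + ‖x‖) *
        Real.sqrt (⨆ z : EuclideanSpace ℝ (Fin d), |u z - v z| / (1 + ‖z‖ ^ 2)) := by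
  intro x p q hp hq
  set N := ⨆ z : EuclideanSpace ℝ (Fin d), |u z - v z| / (1 + ‖z‖ ^ 2)
  have hN : 0 ≤ N := Real.iSup_nonneg fun z => by positivity
  have hup := hp.add_sq_le huconv q
  have hvq := hq.add_sq_le hvconv p
  rw [norm_sub_rev q p] at hvq
  have hp' := hp.norm_sq_le huconv hubound
  have hq' := hq.norm_sq_le hvconv hvbound
  have hdp := (abs_le.1 (abs_sub_le_iSup_mul hubound hvbound hR.le p)).1
  have hdq := (abs_le.1 (abs_sub_le_iSup_mul hubound hvbound hR.le q)).2
  have hsum : ‖p - q‖ ^ 2 ≤ (2 + ‖p‖ ^ 2 + ‖q‖ ^ 2) * N := by linarith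
  have hgrowth : 2 + ‖p‖ ^ 2 + ‖q‖ ^ 2 ≤ 2 * (1 + (8 * R + 2)) * (1 + ‖x‖) ^ 2 := by
    have hx : 0 ≤ R * ‖x‖ := by positivity
    have hx' : 0 ≤ R * ‖x‖ ^ 2 := by positivity
    nlinarith [norm_nonneg x, sq_nonneg ‖x‖]
  refine (sq_le_sq₀ (norm_nonneg _) (by positivity)).1 ?_
  rw [mul_pow, mul_pow, Real.sq_sqrt (by positivity), Real.sq_sqrt hN]
  exact hsum.trans (mul_le_mul_of_nonneg_right hgrowth hN)
end

section
/- Let R > 0 and let u, v : ℝ^d → ℝ be convex functions with −R ≤ u(x) ≤ R(1+|x|²) and −R ≤ v(x) ≤ R(1+|x|²) for all x. Then for every x ∈ ℝ^d, |V_u(x) − V_v(x)| ≤ C₄(R)·(1+|x|²)·‖u − v‖_{𝒢,2}, where C₄(R) := 1 + C₁(R), C₁(R) := 8R+2, and ‖u−v‖_{𝒢,2} := sup_x |u(x)−v(x)|/(1+|x|²). -/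
theorem moreau_bddBelow {d : ℕ} {R : ℝ} {u : EuclideanSpace ℝ (Fin d) → ℝ}
    (hu : ∀ x, -R ≤ u x) (x : EuclideanSpace ℝ (Fin d)) :
    BddBelow (Set.range fun y => (1 / 2) * ‖x - y‖ ^ 2 + u y) := by
  refine ⟨-R, ?_⟩
  rintro _ ⟨y, rfl⟩
  have := hu y
  have := sq_nonneg ‖x - y‖
  dsimp only
  linarith

/-- A near-minimizer in the problem defining the Moreau envelope grows at most linearly. -/
theorem one_add_norm_sq_le_of_near_minimizer {d : ℕ} {R : ℝ} (hR : 0 ≤ R)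
    {v : EuclideanSpace ℝ (Fin d) → ℝ}
    (hv : ∀ x, -R ≤ v x ∧ v x ≤ R * (1 + ‖x‖ ^ 2)) {x y : EuclideanSpace ℝ (Fin d)}
    (hy : (1 / 2) * ‖x - y‖ ^ 2 + v y ≤ v x + 1 / 2) :
    1 + ‖y‖ ^ 2 ≤ (1 + (8 * R + 2)) * (1 + ‖x‖ ^ 2) := by
  have htri : ‖y‖ ≤ ‖x‖ + ‖x - y‖ := by
    simpa [norm_sub_rev] using norm_le_norm_add_norm_sub' y x
  have hsq : ‖y‖ ^ 2 ≤ 2 * ‖x‖ ^ 2 + 2 * ‖x - y‖ ^ 2 := by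
    nlinarith [norm_nonneg y, sq_nonneg (‖x‖ - ‖x - y‖)]
  have := (hv y).1
  have := (hv x).2
  nlinarith [mul_nonneg hR (sq_nonneg ‖x‖), sq_nonneg ‖x‖]

theorem moreau_sub_le {d : ℕ} {R N : ℝ} (hR : 0 ≤ R) (hN : 0 ≤ N)
    {u v : EuclideanSpace ℝ (Fin d) → ℝ} (hu : ∀ x, -R ≤ u x)
    (hv : ∀ x, -R ≤ v x ∧ v x ≤ R * (1 + ‖x‖ ^ 2))
    (huv : ∀ z, u z - v z ≤ N * (1 + ‖z‖ ^ 2)) (x : EuclideanSpace ℝ (Fin d)) :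
    moreau u x - moreau v x ≤ (1 + (8 * R + 2)) * (1 + ‖x‖ ^ 2) * N := by
  refine le_of_forall_pos_le_add fun ε hε => ?_
  have hlt : moreau v x < moreau v x + min ε (1 / 2) :=
    lt_add_of_pos_right _ (lt_min hε (by norm_num))
  obtain ⟨y, hy⟩ := exists_lt_of_ciInf_lt hlt
  have hvx : moreau v x ≤ v x := by
    simpa [moreau] using ciInf_le (moreau_bddBelow (fun z => (hv z).1) x) x
  have huy : moreau u x ≤ (1 / 2) * ‖x - y‖ ^ 2 + u y := ciInf_le (moreau_bddBelow hu x) y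
  have hmin := min_le_left ε (1 / 2 : ℝ)
  have hmin' := min_le_right ε (1 / 2 : ℝ)
  have hgrowth := one_add_norm_sq_le_of_near_minimizer hR hv (x := x) (y := y) (by linarith)
  have := mul_le_mul_of_nonneg_left hgrowth hN
  linarith [huv y]

/-- Let `R > 0` and let `u, v : ℝ^d → ℝ` be convex with
`−R ≤ u(x), v(x) ≤ R(1+|x|²)`.  Then for every `x`,
`|V_u(x) − V_v(x)| ≤ C₄(R)·(1+|x|²)·‖u−v‖_{𝒢,2}` where `C₄(R) = 1+C₁(R)`,
`C₁(R) = 8R+2` and `‖u−v‖_{𝒢,2} = sup_x |u(x)−v(x)|/(1+|x|²)`. -/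
theorem moreau_stability {d : ℕ} (R : ℝ) (hR : 0 < R)
    (u v : EuclideanSpace ℝ (Fin d) → ℝ)
    (huconv : ConvexOn ℝ Set.univ u) (hvconv : ConvexOn ℝ Set.univ v)
    (hubound : ∀ x, -R ≤ u x ∧ u x ≤ R * (1 + ‖x‖ ^ 2))
    (hvbound : ∀ x, -R ≤ v x ∧ v x ≤ R * (1 + ‖x‖ ^ 2)) :
    ∀ x, |moreau u x - moreau v x| ≤ (1 + (8 * R + 2)) * (1 + ‖x‖ ^ 2) *
        (⨆ z : EuclideanSpace ℝ (Fin d), |u z - v z| / (1 + ‖z‖ ^ 2)) := by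
  intro x
  set N := ⨆ z : EuclideanSpace ℝ (Fin d), |u z - v z| / (1 + ‖z‖ ^ 2)
  have hbdd : BddAbove (Set.range fun z => |u z - v z| / (1 + ‖z‖ ^ 2)) := by
    refine ⟨2 * R, ?_⟩
    rintro _ ⟨z, rfl⟩
    have hz := mul_nonneg hR.le (sq_nonneg ‖z‖)
    obtain ⟨hu₁, hu₂⟩ := hubound z
    obtain ⟨hv₁, hv₂⟩ := hvbound z
    dsimp only
    rw [div_le_iff₀ (by positivity), abs_le]
    constructor <;> linarith
  have hN : 0 ≤ N := Real.iSup_nonneg fun z => by positivity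
  have habs : ∀ z, |u z - v z| ≤ N * (1 + ‖z‖ ^ 2) := fun z =>
    (div_le_iff₀ (by positivity)).1 (le_ciSup hbdd z)
  rw [abs_sub_le_iff]
  exact ⟨moreau_sub_le hR.le hN (fun z => (hubound z).1) hvbound
      (fun z => (abs_sub_le_iff.1 (habs z)).1) x,
    moreau_sub_le hR.le hN (fun z => (hvbound z).1) hubound
      (fun z => (abs_sub_le_iff.1 (habs z)).2) x⟩
end

section
/- Let R > 0 and let ℳ be a nonempty set of Borel probability measures on ℝ^d, each with second moment at most R (∫|y|² dξ(y) ≤ R for all ξ ∈ ℳ). For u : ℝ^d → ℝ convex with −R ≤ u(x) ≤ R(1+|x|²), define Υ[u](x) := sup_{ξ∈ℳ} ∫ u(x+y) dξ(y). Then: (1) Υ[u] is convex and satisfies −2R(1+R) ≤ Υ[u](x) ≤ 2R(1+R)(1+|x|²) for all x; (2) for any two such functions u, v, sup_x |Υ[u](x) − Υ[v](x)|/(1+|x|²) ≤ 2(1+R) · sup_x |u(x) − v(x)|/(1+|x|²). -/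
open MeasureTheory ENNReal

/-- `Υ[u](x) = sup_{ξ ∈ ℳ} ∫ u(x+y) dξ(y)`. -/
noncomputable def Ups {d : ℕ} (M : Set (Measure (EuclideanSpace ℝ (Fin d))))
    (u : EuclideanSpace ℝ (Fin d) → ℝ) (x : EuclideanSpace ℝ (Fin d)) : ℝ :=
  ⨆ ξ : M, ∫ y, u (x + y) ∂(ξ : Measure (EuclideanSpace ℝ (Fin d)))

/-- A measure whose second moment is at most `R` integrates `‖·‖²` to at most `R`. -/
lemma integrable_norm_sq_of_lintegral_le {E : Type*} [NormedAddCommGroup E] [MeasurableSpace E]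
    [OpensMeasurableSpace E] {ξ : Measure E} {R : ℝ} (hR : 0 ≤ R)
    (h : ∫⁻ y, (‖y‖₊ : ℝ≥0∞) ^ (2 : ℕ) ∂ξ ≤ ENNReal.ofReal R) :
    Integrable (fun y : E => ‖y‖ ^ 2) ξ ∧ ∫ y, ‖y‖ ^ 2 ∂ξ ≤ R := by
  have hmeas : AEStronglyMeasurable (fun y : E => ‖y‖ ^ 2) ξ := by fun_prop
  have heq : ∫⁻ y, ENNReal.ofReal (‖y‖ ^ 2) ∂ξ = ∫⁻ y, (‖y‖₊ : ℝ≥0∞) ^ (2 : ℕ) ∂ξ := by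
    refine lintegral_congr fun y => ?_
    rw [ENNReal.ofReal_pow (norm_nonneg y), ofReal_norm, enorm_eq_nnnorm]
  have hnn : 0 ≤ᵐ[ξ] fun y : E => ‖y‖ ^ 2 := Filter.Eventually.of_forall fun y => by positivity
  refine ⟨⟨hmeas, ?_⟩, ?_⟩
  · rw [hasFiniteIntegral_iff_ofReal hnn, heq]
    exact h.trans_lt ofReal_lt_top
  · rw [integral_eq_lintegral_of_nonneg_ae hnn hmeas, heq]
    exact ENNReal.toReal_le_of_le_ofReal hR h

/-- Translates of the weight `1 + ‖·‖²` are integrable against a probability measure with second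
moment at most `R`, with integral at most `2 (1 + R) (1 + ‖x‖²)`. -/
lemma integrable_one_add_norm_sq_translate {E : Type*} [NormedAddCommGroup E] [MeasurableSpace E]
    [BorelSpace E] [SecondCountableTopology E] {ξ : Measure E} [IsProbabilityMeasure ξ] {R : ℝ}
    (hR : 0 ≤ R) (h : ∫⁻ y, (‖y‖₊ : ℝ≥0∞) ^ (2 : ℕ) ∂ξ ≤ ENNReal.ofReal R) (x : E) :
    Integrable (fun y : E => 1 + ‖x + y‖ ^ 2) ξ ∧
      ∫ y, (1 + ‖x + y‖ ^ 2) ∂ξ ≤ 2 * (1 + R) * (1 + ‖x‖ ^ 2) := by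
  obtain ⟨hi, hle⟩ := integrable_norm_sq_of_lintegral_le hR h
  have hbound : ∀ y : E, 1 + ‖x + y‖ ^ 2 ≤ (1 + 2 * ‖x‖ ^ 2) + 2 * ‖y‖ ^ 2 := fun y => by
    nlinarith [norm_add_le x y, norm_nonneg (x + y), norm_nonneg x, norm_nonneg y,
      sq_nonneg (‖x‖ - ‖y‖)]
  have hdom : Integrable (fun y : E => (1 + 2 * ‖x‖ ^ 2) + 2 * ‖y‖ ^ 2) ξ :=
    (integrable_const _).add (hi.const_mul 2)
  have hint : Integrable (fun y : E => 1 + ‖x + y‖ ^ 2) ξ := by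
    refine hdom.mono' (Continuous.aestronglyMeasurable (by fun_prop))
      (Filter.Eventually.of_forall fun y => ?_)
    rw [Real.norm_of_nonneg (by positivity)]
    exact hbound y
  refine ⟨hint, (integral_mono hint hdom hbound).trans ?_⟩
  rw [integral_add (integrable_const _) (hi.const_mul 2), integral_const_mul]
  simp only [integral_const, probReal_univ, one_smul]
  nlinarith [mul_nonneg hR (sq_nonneg ‖x‖)]

/-- Translates of a continuous function of quadratic growth are integrable, with a bound on the
integral. -/
lemma integrable_translate_of_quadratic_growth {E : Type*} [NormedAddCommGroup E]
    [MeasurableSpace E] [BorelSpace E] [SecondCountableTopology E] {ξ : Measure E}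
    [IsProbabilityMeasure ξ] {R : ℝ} (hR : 0 ≤ R)
    (h : ∫⁻ y, (‖y‖₊ : ℝ≥0∞) ^ (2 : ℕ) ∂ξ ≤ ENNReal.ofReal R) {f : E → ℝ} (hf : Continuous f)
    {C : ℝ} (hC : 0 ≤ C) (hfC : ∀ z, |f z| ≤ C * (1 + ‖z‖ ^ 2)) (x : E) :
    Integrable (fun y => f (x + y)) ξ ∧
      |∫ y, f (x + y) ∂ξ| ≤ C * (2 * (1 + R) * (1 + ‖x‖ ^ 2)) := by
  obtain ⟨hi, hle⟩ := integrable_one_add_norm_sq_translate hR h x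
  have hint : Integrable (fun y => f (x + y)) ξ :=
    (hi.const_mul C).mono' (Continuous.aestronglyMeasurable (by fun_prop))
      (Filter.Eventually.of_forall fun y => hfC (x + y))
  refine ⟨hint, abs_integral_le_integral_abs.trans ?_⟩
  refine (integral_mono hint.abs (hi.const_mul C) fun y => hfC (x + y)).trans ?_
  rw [integral_const_mul]
  exact mul_le_mul_of_nonneg_left hle hC

/-- Let `R > 0` and let `ℳ` be a nonempty set of Borel probability
measures on `ℝ^d` with second moments at most `R`.  For `u` convex with
`−R ≤ u ≤ R(1+|·|²)`, the map `Υ[u]` is convex with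
`−2R(1+R) ≤ Υ[u] ≤ 2R(1+R)(1+|·|²)`, and `u ↦ Υ[u]` is Lipschitz with modulus
`2(1+R)` for the weighted norm `‖f‖_{𝒢,2} = sup_x |f(x)|/(1+|x|²)`. -/
theorem Ups_properties {d : ℕ} (R : ℝ) (hR : 0 < R)
    (M : Set (Measure (EuclideanSpace ℝ (Fin d)))) (hMne : M.Nonempty)
    (hM : ∀ ξ ∈ M, IsProbabilityMeasure ξ ∧
      ∫⁻ y, (‖y‖₊ : ℝ≥0∞) ^ (2 : ℕ) ∂ξ ≤ ENNReal.ofReal R) :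
    (∀ u : EuclideanSpace ℝ (Fin d) → ℝ, ConvexOn ℝ Set.univ u →
      (∀ x, -R ≤ u x ∧ u x ≤ R * (1 + ‖x‖ ^ 2)) →
      ConvexOn ℝ Set.univ (Ups M u) ∧
      ∀ x, -(2 * R * (1 + R)) ≤ Ups M u x ∧
        Ups M u x ≤ 2 * R * (1 + R) * (1 + ‖x‖ ^ 2)) ∧
    (∀ u v : EuclideanSpace ℝ (Fin d) → ℝ,
      ConvexOn ℝ Set.univ u → (∀ x, -R ≤ u x ∧ u x ≤ R * (1 + ‖x‖ ^ 2)) →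
      ConvexOn ℝ Set.univ v → (∀ x, -R ≤ v x ∧ v x ≤ R * (1 + ‖x‖ ^ 2)) →
      (⨆ x : EuclideanSpace ℝ (Fin d), |Ups M u x - Ups M v x| / (1 + ‖x‖ ^ 2)) ≤
        2 * (1 + R) *
          (⨆ x : EuclideanSpace ℝ (Fin d), |u x - v x| / (1 + ‖x‖ ^ 2))) := by
  have hgrowth : ∀ u : EuclideanSpace ℝ (Fin d) → ℝ,
      (∀ x, -R ≤ u x ∧ u x ≤ R * (1 + ‖x‖ ^ 2)) → ∀ x, |u x| ≤ R * (1 + ‖x‖ ^ 2) := by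
    intro u hu x
    exact abs_le.2 ⟨by nlinarith [(hu x).1, mul_nonneg hR.le (sq_nonneg ‖x‖)], (hu x).2⟩
  have hcont : ∀ u : EuclideanSpace ℝ (Fin d) → ℝ, ConvexOn ℝ Set.univ u → Continuous u :=
    fun u hu => continuousOn_univ.1 (hu.continuousOn isOpen_univ)
  have hint : ∀ u : EuclideanSpace ℝ (Fin d) → ℝ, ConvexOn ℝ Set.univ u →
      (∀ x, -R ≤ u x ∧ u x ≤ R * (1 + ‖x‖ ^ 2)) → ∀ ξ ∈ M, ∀ x,
      Integrable (fun y => u (x + y)) ξ ∧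
        |∫ y, u (x + y) ∂ξ| ≤ R * (2 * (1 + R) * (1 + ‖x‖ ^ 2)) := by
    intro u hu hub ξ hξ x
    have := (hM ξ hξ).1
    exact integrable_translate_of_quadratic_growth hR.le (hM ξ hξ).2 (hcont u hu) hR.le
      (hgrowth u hub) x
  have hne : Nonempty M := hMne.to_subtype
  have hle : ∀ u : EuclideanSpace ℝ (Fin d) → ℝ, ConvexOn ℝ Set.univ u →
      (∀ x, -R ≤ u x ∧ u x ≤ R * (1 + ‖x‖ ^ 2)) → ∀ ξ ∈ M, ∀ x,
      ∫ y, u (x + y) ∂ξ ≤ Ups M u x := by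
    intro u hu hub ξ hξ x
    refine le_ciSup (f := fun ξ : M =>
      ∫ y, u (x + y) ∂(ξ : Measure (EuclideanSpace ℝ (Fin d)))) ?_ ⟨ξ, hξ⟩
    refine ⟨R * (2 * (1 + R) * (1 + ‖x‖ ^ 2)), ?_⟩
    rintro _ ⟨η, rfl⟩
    exact (le_abs_self _).trans (hint u hu hub η η.2 x).2
  refine ⟨fun u hu hub => ⟨⟨convex_univ, ?_⟩, fun x => ⟨?_, ?_⟩⟩, ?_⟩
  · intro x _ z _ a b ha hb hab
    refine ciSup_le fun ξ => ?_
    have hx := (hint u hu hub ξ ξ.2 x).1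
    have hz := (hint u hu hub ξ ξ.2 z).1
    calc ∫ y, u (a • x + b • z + y) ∂(ξ : Measure (EuclideanSpace ℝ (Fin d)))
        ≤ ∫ y, (a * u (x + y) + b * u (z + y)) ∂(ξ : Measure (EuclideanSpace ℝ (Fin d))) := by
          refine integral_mono (hint u hu hub ξ ξ.2 _).1
            ((hx.const_mul a).add (hz.const_mul b)) fun y => ?_
          have hy : a • x + b • z + y = a • (x + y) + b • (z + y) := by
            rw [smul_add, smul_add, add_add_add_comm, ← add_smul, hab, one_smul]
          dsimp only
          rw [hy]
          exact hu.2 (Set.mem_univ _) (Set.mem_univ _) ha hb hab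
      _ = a * ∫ y, u (x + y) ∂(ξ : Measure (EuclideanSpace ℝ (Fin d))) +
          b * ∫ y, u (z + y) ∂(ξ : Measure (EuclideanSpace ℝ (Fin d))) := by
          rw [integral_add (hx.const_mul a) (hz.const_mul b), integral_const_mul,
            integral_const_mul]
      _ ≤ a • Ups M u x + b • Ups M u z := by
          simp only [smul_eq_mul]
          gcongr
          · exact hle u hu hub ξ ξ.2 x
          · exact hle u hu hub ξ ξ.2 z
  · obtain ⟨ξ, hξ⟩ := hMne
    have := (hM ξ hξ).1
    have hlow : -R ≤ ∫ y, u (x + y) ∂ξ := by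
      have := integral_mono (integrable_const (-R)) (hint u hu hub ξ hξ x).1
        fun y => (hub (x + y)).1
      simpa using this
    nlinarith [hle u hu hub ξ hξ x]
  · refine ciSup_le fun ξ => ((le_abs_self _).trans (hint u hu hub ξ ξ.2 x).2).trans_eq ?_
    ring
  · intro u v hu hub hv hvb
    set D := ⨆ x : EuclideanSpace ℝ (Fin d), |u x - v x| / (1 + ‖x‖ ^ 2) with hD
    have hbdd : BddAbove (Set.range fun x : EuclideanSpace ℝ (Fin d) =>
        |u x - v x| / (1 + ‖x‖ ^ 2)) := by
      refine ⟨2 * R, ?_⟩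
      rintro _ ⟨x, rfl⟩
      have hpos : 0 < 1 + ‖x‖ ^ 2 := by positivity
      rw [div_le_iff₀ hpos]
      linarith [abs_sub (u x) (v x), hgrowth u hub x, hgrowth v hvb x]
    have hD0 : 0 ≤ D := Real.iSup_nonneg fun x => by positivity
    have hdiff : ∀ x, |u x - v x| ≤ D * (1 + ‖x‖ ^ 2) := fun x =>
      (div_le_iff₀ (by positivity)).1 (le_ciSup hbdd x)
    have hclose : ∀ ξ ∈ M, ∀ x,
        |∫ y, u (x + y) ∂ξ - ∫ y, v (x + y) ∂ξ| ≤ D * (2 * (1 + R) * (1 + ‖x‖ ^ 2)) := by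
      intro ξ hξ x
      have := (hM ξ hξ).1
      rw [← integral_sub (hint u hu hub ξ hξ x).1 (hint v hv hvb ξ hξ x).1]
      exact (integrable_translate_of_quadratic_growth hR.le (hM ξ hξ).2
        ((hcont u hu).sub (hcont v hv)) hD0 hdiff x).2
    refine ciSup_le fun x => ?_
    rw [div_le_iff₀ (by positivity), abs_sub_le_iff]
    constructor
    · rw [sub_le_iff_le_add]
      refine ciSup_le fun ξ => ?_
      linarith [(abs_le.1 (hclose ξ ξ.2 x)).2, hle v hv hvb ξ ξ.2 x]
    · rw [sub_le_iff_le_add]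
      refine ciSup_le fun ξ => ?_
      linarith [(abs_le.1 (hclose ξ ξ.2 x)).1, hle u hu hub ξ ξ.2 x]
end

section
/- Let T ∈ ℕ* and C > 0. For each t ∈ {0,…,T−1}, let M_t be a nonempty set of Borel probability measures on ℝ^d, each with second moment at most C; for each t ∈ {0,…,T}, let F_t : ℝ^d → ℝ be convex with −C ≤ F_t(x) ≤ C(1+|x|²); and for each t ∈ {0,…,T−1}, let p_t ∈ ℝ^d with |p_t| ≤ C. Then there exists a unique triple (u, ū, α), with u(t,·) and ū(s,·) functions ℝ^d → ℝ of at most quadratic growth (t ∈ {0,…,T}, s ∈ {1,…,T}) and each α_t : ℝ^d → ℝ^d of at most linear growth and 1-Lipschitz, such that for all t ∈ {0,…,T−1} and x ∈ ℝ^d: u(T,x) = F_T(x); ū(t+1,x) = sup_{ξ∈M_t} ∫ u(t+1, x+y) dξ(y); u(t,x) = inf_{a∈ℝ^d} ( ½|a|² + ⟨a,p_t⟩ + F_t(x) + ū(t+1, x+a) ); and α_t(x) is the unique minimizer of a ↦ ½|a|² + ⟨a,p_t⟩ + F_t(x) + ū(t+1, x+a). Moreover there exist constants C_u, C_α > 0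 depending only on C and T such that each u(t,·) is convex with −C_u ≤ u(t,x) ≤ C_u(1+|x|²), and each α_t satisfies |α_t(x)| ≤ C_α(1+|x|) and is 1-Lipschitz. -/
open MeasureTheory ENNReal
open scoped RealInnerProductSpace

/-- `ℝ^d` with the Euclidean norm. -/
abbrev Euc (d : ℕ) := EuclideanSpace ℝ (Fin d)

/-- The cost minimized at time `t`:
`a ↦ ½|a|² + ⟨a,p_t⟩ + F_t(x) + ū(t+1, x+a)`. -/
noncomputable def dpCost {d : ℕ} (pt : Euc d) (Ftx : ℝ) (ubarNext : Euc d → ℝ)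
    (x a : Euc d) : ℝ :=
  (1 / 2) * ‖a‖ ^ 2 + ⟪a, pt⟫ + Ftx + ubarNext (x + a)

/-- `(u, ū, α)` is a solution of the dynamic programming system:
`u`, `ū` have at most quadratic growth, each `α_t` has at most linear growth and is
`1`-Lipschitz, `u(T,·) = F_T`, `ū(t+1,·)` is the robust expectation of `u(t+1,·)`,
`u(t,·)` is given by the infimum of the cost, and `α_t(x)` is its unique minimizer. -/
def IsDPSolution (T : ℕ) {d : ℕ} (M : ℕ → Set (Measure (Euc d)))
    (F : ℕ → Euc d → ℝ) (p : ℕ → Euc d)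
    (u ubar : ℕ → Euc d → ℝ) (α : ℕ → Euc d → Euc d) : Prop :=
  (∀ t ≤ T, ∃ K : ℝ, ∀ x, |u t x| ≤ K * (1 + ‖x‖ ^ 2)) ∧
  (∀ t, 1 ≤ t → t ≤ T → ∃ K : ℝ, ∀ x, |ubar t x| ≤ K * (1 + ‖x‖ ^ 2)) ∧
  (∀ t < T, (∃ K : ℝ, ∀ x, ‖α t x‖ ≤ K * (1 + ‖x‖)) ∧ LipschitzWith 1 (α t)) ∧
  (∀ x, u T x = F T x) ∧
  (∀ t < T, ∀ x, ubar (t + 1) x = ⨆ ξ : M t, ∫ y, u (t + 1) (x + y) ∂(ξ : Measure (Euc d))) ∧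
  (∀ t < T, ∀ x, u t x = ⨅ a : Euc d, dpCost (p t) (F t x) (ubar (t + 1)) x a) ∧
  (∀ t < T, ∀ x,
    (∀ a, dpCost (p t) (F t x) (ubar (t + 1)) x (α t x) ≤
      dpCost (p t) (F t x) (ubar (t + 1)) x a) ∧
    (∀ a, (∀ a', dpCost (p t) (F t x) (ubar (t + 1)) x a ≤
      dpCost (p t) (F t x) (ubar (t + 1)) x a') → a = α t x))

/-- The robust expectation `x ↦ sup_{ξ ∈ N} ∫ v(x+y) dξ(y)`. -/
noncomputable def robustExp {d : ℕ} (N : Set (Measure (Euc d))) (v : Euc d → ℝ)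
    (x : Euc d) : ℝ :=
  ⨆ ξ : N, ∫ y, v (x + y) ∂(ξ : Measure (Euc d))

/-- The value function of the dynamic programming system, indexed by the time to go. -/
noncomputable def backwardValue (T : ℕ) {d : ℕ} (M : ℕ → Set (Measure (Euc d)))
    (F : ℕ → Euc d → ℝ) (p : ℕ → Euc d) : ℕ → Euc d → ℝ
  | 0 => F T
  | k + 1 => fun x => ⨅ a : Euc d, dpCost (p (T - (k + 1))) (F (T - (k + 1)) x)
      (robustExp (M (T - (k + 1))) (backwardValue T M F p k)) x a

/-- The bound on the value function with `k` steps to go. -/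
noncomputable def valueBound (C : ℝ) : ℕ → ℝ
  | 0 => C
  | k + 1 => C ^ 2 / 2 + C + (2 + 2 * C) * valueBound C k

/-- Convex functions on `ℝ^d` with `-B ≤ v(x) ≤ B(1+|x|²)`. -/
def IsConvexQuadraticBounded {d : ℕ} (B : ℝ) (v : Euc d → ℝ) : Prop :=
  ConvexOn ℝ Set.univ v ∧ ∀ x, -B ≤ v x ∧ v x ≤ B * (1 + ‖x‖ ^ 2)

theorem IsConvexQuadraticBounded.continuous {d : ℕ} {B : ℝ} {v : Euc d → ℝ}
    (hv : IsConvexQuadraticBounded B v) : Continuous v :=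
  hv.1.locallyLipschitz.continuous

theorem IsConvexQuadraticBounded.mono {d : ℕ} {B B' : ℝ} {v : Euc d → ℝ}
    (hv : IsConvexQuadraticBounded B v) (h : B ≤ B') : IsConvexQuadraticBounded B' v := by
  refine ⟨hv.1, fun x => ⟨by linarith [(hv.2 x).1], (hv.2 x).2.trans ?_⟩⟩
  gcongr

theorem integrable_sq_norm_of_lintegral_le {d : ℕ} {ξ : Measure (Euc d)} {C : ℝ}
    (hξ : ∫⁻ y, (‖y‖₊ : ℝ≥0∞) ^ (2 : ℕ) ∂ξ ≤ ENNReal.ofReal C) :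
    Integrable (fun y => ‖y‖ ^ 2) ξ := by
  refine ⟨by fun_prop, lt_of_le_of_lt ?_ (hξ.trans_lt ENNReal.ofReal_lt_top)⟩
  refine lintegral_mono fun y => ?_
  simp [enorm_eq_nnnorm]

theorem integral_sq_norm_le_of_lintegral_le {d : ℕ} {ξ : Measure (Euc d)} {C : ℝ} (hC : 0 ≤ C)
    (hξ : ∫⁻ y, (‖y‖₊ : ℝ≥0∞) ^ (2 : ℕ) ∂ξ ≤ ENNReal.ofReal C) :
    ∫ y, ‖y‖ ^ 2 ∂ξ ≤ C := by
  rw [integral_eq_lintegral_of_nonneg_ae (Filter.Eventually.of_forall fun y => by positivity)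
    (by fun_prop)]
  refine ENNReal.toReal_le_of_le_ofReal hC (le_trans (le_of_eq ?_) hξ)
  refine lintegral_congr fun y => ?_
  rw [ENNReal.ofReal_pow (norm_nonneg y), ofReal_norm, enorm_eq_nnnorm]

theorem sq_norm_add_le_two_mul {d : ℕ} (x y : Euc d) :
    ‖x + y‖ ^ 2 ≤ 2 * ‖x‖ ^ 2 + 2 * ‖y‖ ^ 2 := by
  nlinarith [norm_add_le x y, norm_nonneg (x + y), sq_nonneg (‖x‖ - ‖y‖)]

section RobustExpectation

variable {d : ℕ} {B C : ℝ} {v : Euc d → ℝ} {ξ : Measure (Euc d)}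

theorem IsConvexQuadraticBounded.integrable_translate [IsProbabilityMeasure ξ]
    (hv : IsConvexQuadraticBounded B v) (hB : 0 ≤ B)
    (hξ : ∫⁻ y, (‖y‖₊ : ℝ≥0∞) ^ (2 : ℕ) ∂ξ ≤ ENNReal.ofReal C) (x : Euc d) :
    Integrable (fun y => v (x + y)) ξ := by
  have hc := hv.continuous
  refine Integrable.mono' (g := fun y => B * (1 + 2 * ‖x‖ ^ 2) + 2 * B * ‖y‖ ^ 2)
    ((integrable_const _).add ((integrable_sq_norm_of_lintegral_le hξ).const_mul _))
    (by fun_prop) (Filter.Eventually.of_forall fun y => ?_)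
  have h1 := hv.2 (x + y)
  have h2 := mul_le_mul_of_nonneg_left (sq_norm_add_le_two_mul x y) hB
  have h3 : 0 ≤ B * ‖x‖ ^ 2 := by positivity
  have h4 : 0 ≤ B * ‖y‖ ^ 2 := by positivity
  rw [Real.norm_eq_abs, abs_le]
  constructor <;> linarith

theorem IsConvexQuadraticBounded.integral_translate_mem_Icc [IsProbabilityMeasure ξ]
    (hv : IsConvexQuadraticBounded B v) (hB : 0 ≤ B) (hC : 0 ≤ C)
    (hξ : ∫⁻ y, (‖y‖₊ : ℝ≥0∞) ^ (2 : ℕ) ∂ξ ≤ ENNReal.ofReal C) (x : Euc d) :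
    ∫ y, v (x + y) ∂ξ ∈ Set.Icc (-B) ((2 + 2 * C) * B * (1 + ‖x‖ ^ 2)) := by
  have hi := hv.integrable_translate hB hξ x
  have hq := integrable_sq_norm_of_lintegral_le hξ
  constructor
  · simpa using integral_mono (integrable_const (-B)) hi fun y => (hv.2 (x + y)).1
  · have h1 : ∫ y, v (x + y) ∂ξ ≤ ∫ y, (B * (1 + 2 * ‖x‖ ^ 2) + 2 * B * ‖y‖ ^ 2) ∂ξ := by
      refine integral_mono hi ((integrable_const _).add (hq.const_mul _)) fun y => ?_
      have h2 := mul_le_mul_of_nonneg_left (sq_norm_add_le_two_mul x y) hB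
      have h3 := (hv.2 (x + y)).2
      change v (x + y) ≤ B * (1 + 2 * ‖x‖ ^ 2) + 2 * B * ‖y‖ ^ 2
      linarith
    rw [integral_add (integrable_const _) (hq.const_mul _), integral_const_mul (2 * B)] at h1
    simp only [integral_const, probReal_univ, one_smul] at h1
    have h4 := mul_le_mul_of_nonneg_left (integral_sq_norm_le_of_lintegral_le hC hξ) hB
    have h5 : 0 ≤ C * B * ‖x‖ ^ 2 := by positivity
    nlinarith

theorem IsConvexQuadraticBounded.robustExp {N : Set (Measure (Euc d))} (hN : N.Nonempty)
    (hξ : ∀ ξ ∈ N, IsProbabilityMeasure ξ ∧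
      ∫⁻ y, (‖y‖₊ : ℝ≥0∞) ^ (2 : ℕ) ∂ξ ≤ ENNReal.ofReal C)
    (hv : IsConvexQuadraticBounded B v) (hB : 0 ≤ B) (hC : 0 ≤ C) :
    IsConvexQuadraticBounded ((2 + 2 * C) * B) (robustExp N v) := by
  have : Nonempty N := hN.to_subtype
  have key : ∀ x, ∀ ξ : N, ∫ y, v (x + y) ∂(ξ : Measure (Euc d)) ∈
      Set.Icc (-B) ((2 + 2 * C) * B * (1 + ‖x‖ ^ 2)) := fun x ξ =>
    have := (hξ ξ ξ.2).1
    hv.integral_translate_mem_Icc hB hC (hξ ξ ξ.2).2 x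
  have bdd : ∀ x, BddAbove (Set.range fun ξ : N => ∫ y, v (x + y) ∂(ξ : Measure (Euc d))) := by
    intro x
    refine ⟨(2 + 2 * C) * B * (1 + ‖x‖ ^ 2), ?_⟩
    rintro _ ⟨ξ, rfl⟩
    exact (key x ξ).2
  refine ⟨⟨convex_univ, fun x _ z _ a b ha hb hab => ?_⟩, fun x =>
    ⟨?_, ciSup_le fun ξ => (key x ξ).2⟩⟩
  · refine ciSup_le fun ξ => ?_
    have := (hξ ξ ξ.2).1
    have hi := hv.integrable_translate hB (hξ ξ ξ.2).2
    have h1 : ∫ y, v (a • x + b • z + y) ∂(ξ : Measure (Euc d)) ≤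
        ∫ y, (a * v (x + y) + b * v (z + y)) ∂(ξ : Measure (Euc d)) := by
      refine integral_mono (hi _) (((hi x).const_mul a).add ((hi z).const_mul b)) fun y => ?_
      have h2 := hv.1.2 (Set.mem_univ (x + y)) (Set.mem_univ (z + y)) ha hb hab
      have h3 : a • (x + y) + b • (z + y) = a • x + b • z + y := by
        rw [smul_add, smul_add, add_add_add_comm, ← add_smul, hab, one_smul]
      rw [h3] at h2
      simpa using h2
    rw [integral_add ((hi x).const_mul a) ((hi z).const_mul b), integral_const_mul,
      integral_const_mul] at h1
    exact h1.trans (add_le_add (mul_le_mul_of_nonneg_left (le_ciSup (bdd x) ξ) ha)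
      (mul_le_mul_of_nonneg_left (le_ciSup (bdd z) ξ) hb))
  · obtain ⟨ξ⟩ := this
    have h1 := (key x ξ).1
    have h2 : ∫ y, v (x + y) ∂(ξ : Measure (Euc d)) ≤ _root_.robustExp N v x := le_ciSup (bdd x) ξ
    have h3 : 0 ≤ C * B := by positivity
    linarith

end RobustExpectation

section Minimization

variable {d : ℕ} {B C f : ℝ} {F g : Euc d → ℝ} {q : Euc d}

theorem dpCost_convex_combination (hF : ConvexOn ℝ Set.univ F) (hg : ConvexOn ℝ Set.univ g)
    {s t : ℝ} (hs : 0 ≤ s) (ht : 0 ≤ t) (hst : s + t = 1) (x z a b : Euc d) :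
    dpCost q (F (s • x + t • z)) g (s • x + t • z) (s • a + t • b) ≤
      s * dpCost q (F x) g x a + t * dpCost q (F z) g z b := by
  have h1 := hF.2 (Set.mem_univ x) (Set.mem_univ z) hs ht hst
  have h2 := hg.2 (Set.mem_univ (x + a)) (Set.mem_univ (z + b)) hs ht hst
  have h3 : s • (x + a) + t • (z + b) = s • x + t • z + (s • a + t • b) := by module
  have h4 := (convexOn_univ_norm.pow (fun _ _ => norm_nonneg _) 2).2
    (Set.mem_univ a) (Set.mem_univ b) hs ht hst
  rw [h3] at h2
  simp only [Pi.pow_apply, smul_eq_mul] at h1 h2 h4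
  simp only [dpCost, inner_add_left, real_inner_smul_left]
  linarith

theorem nonneg_of_forall_add_mul_nonneg {a b : ℝ}
    (h : ∀ s : ℝ, 0 < s → s ≤ 1 → 0 ≤ a + s * b) : 0 ≤ a := by
  by_contra! ha
  have hb : 0 < |b| + 1 := by positivity
  have hs : 0 < min 1 (-a / (2 * (|b| + 1))) := lt_min one_pos (by apply div_pos <;> linarith)
  have h1 := h _ hs (min_le_left _ _)
  have h2 : min 1 (-a / (2 * (|b| + 1))) * (2 * (|b| + 1)) ≤ -a := by
    rw [← le_div_iff₀ (by linarith)]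
    exact min_le_right _ _
  nlinarith [le_abs_self b]

/-- The first-order optimality condition for the cost. -/
theorem inner_add_nonneg_of_dpCost_minimizer (hg : ConvexOn ℝ Set.univ g) {x a : Euc d}
    (ha : ∀ b, dpCost q f g x a ≤ dpCost q f g x b) (b : Euc d) :
    0 ≤ ⟪a + q, b - a⟫ + g (x + b) - g (x + a) := by
  refine nonneg_of_forall_add_mul_nonneg (b := ‖b - a‖ ^ 2 / 2) fun s hs hs1 => ?_
  have h1 := ha (a + s • (b - a))
  have h2 := hg.2 (Set.mem_univ (x + a)) (Set.mem_univ (x + b)) (sub_nonneg.2 hs1) hs.le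
    (sub_add_cancel 1 s)
  have h3 : (1 - s) • (x + a) + s • (x + b) = x + (a + s • (b - a)) := by module
  rw [h3] at h2
  simp only [dpCost, norm_add_sq_real, norm_smul, inner_add_left, real_inner_smul_left,
    real_inner_smul_right, Real.norm_eq_abs, abs_of_pos hs, smul_eq_mul] at h1 h2 ⊢
  rw [real_inner_comm (b - a) q]
  refine nonneg_of_mul_nonneg_right (a := s) ?_ hs
  nlinarith

/-- Minimizers of the cost depend on the state in a `1`-Lipschitz way. -/
theorem norm_sub_le_of_dpCost_minimizer (hg : ConvexOn ℝ Set.univ g) {f' : ℝ} {x z a b : Euc d}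
    (ha : ∀ c, dpCost q f g x a ≤ dpCost q f g x c)
    (hb : ∀ c, dpCost q f' g z b ≤ dpCost q f' g z c) : ‖a - b‖ ≤ ‖x - z‖ := by
  have h1 := inner_add_nonneg_of_dpCost_minimizer hg ha (z + b - x)
  have h2 := inner_add_nonneg_of_dpCost_minimizer hg hb (x + a - z)
  rw [add_sub_cancel] at h1 h2
  have h3 : ⟪a + q, z + b - x - a⟫ + ⟪b + q, x + a - z - b⟫ = -⟪a - b, x - z⟫ - ‖a - b‖ ^ 2 := by
    rw [← real_inner_self_eq_norm_sq]
    simp only [inner_add_left, inner_sub_left, inner_add_right, inner_sub_right]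
    ring
  have h4 : -⟪a - b, x - z⟫ ≤ ‖a - b‖ * ‖x - z‖ :=
    (neg_le_abs _).trans (abs_real_inner_le_norm _ _)
  by_contra! h
  nlinarith [norm_nonneg (x - z)]

theorem half_sq_sub_le_dpCost (hB : ∀ x, -B ≤ g x) (hq : ‖q‖ ≤ C) (x a : Euc d) :
    1 / 2 * ‖a‖ ^ 2 - C * ‖a‖ + f - B ≤ dpCost q f g x a := by
  have h1 : -⟪a, q⟫ ≤ ‖a‖ * ‖q‖ := (neg_le_abs _).trans (abs_real_inner_le_norm _ _)
  have h2 := mul_le_mul_of_nonneg_left hq (norm_nonneg a)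
  have h3 := hB (x + a)
  unfold dpCost
  linarith

theorem norm_le_of_dpCost_le_dpCost_zero (hB : ∀ x, -B ≤ g x) (hq : ‖q‖ ≤ C) {x a : Euc d}
    (ha : dpCost q f g x a ≤ dpCost q f g x 0) : ‖a‖ ≤ 2 * C + 1 + 2 * (g x + B) := by
  have h1 := half_sq_sub_le_dpCost (f := f) hB hq x a
  have h2 : dpCost q f g x 0 = f + g x := by simp [dpCost]
  have h3 := hB x
  have hC := (norm_nonneg q).trans hq
  by_contra! h
  have h4 : 0 < ‖a‖ - 1 := by linarith
  nlinarith [mul_pos h4 h4]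

theorem exists_dpCost_minimizer (hg : Continuous g) (hB : ∀ x, -B ≤ g x) (hq : ‖q‖ ≤ C)
    (x : Euc d) : ∃ a, ∀ b, dpCost q f g x a ≤ dpCost q f g x b := by
  refine Continuous.exists_forall_le_of_isBounded (by unfold dpCost; fun_prop) 0 ?_
  refine (Metric.isBounded_closedBall (x := (0 : Euc d))
    (r := 2 * C + 1 + 2 * (g x + B))).subset fun a ha => ?_
  rw [mem_closedBall_zero_iff]
  exact norm_le_of_dpCost_le_dpCost_zero hB hq ha

theorem iInf_dpCost_eq_of_minimizer {x a : Euc d}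
    (ha : ∀ b, dpCost q f g x a ≤ dpCost q f g x b) :
    ⨅ b, dpCost q f g x b = dpCost q f g x a :=
  le_antisymm (ciInf_le ⟨_, by rintro _ ⟨b, rfl⟩; exact ha b⟩ a) (le_ciInf ha)

theorem IsConvexQuadraticBounded.iInf_dpCost (hF : IsConvexQuadraticBounded C F)
    (hg : IsConvexQuadraticBounded B g) (hq : ‖q‖ ≤ C) :
    IsConvexQuadraticBounded (C ^ 2 / 2 + C + B) fun x => ⨅ a, dpCost q (F x) g x a := by
  have hB := fun x => (hg.2 x).1
  choose α hα using fun x => exists_dpCost_minimizer (f := F x) hg.continuous hB hq x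
  have h : (fun x => ⨅ a, dpCost q (F x) g x a) = fun x => dpCost q (F x) g x (α x) :=
    funext fun x => iInf_dpCost_eq_of_minimizer (hα x)
  rw [h]
  refine ⟨⟨convex_univ, fun x _ z _ s t hs ht hst => ?_⟩, fun x => ⟨?_, ?_⟩⟩
  · exact (hα _ _).trans (dpCost_convex_combination hF.1 hg.1 hs ht hst x z _ _)
  · have h1 := half_sq_sub_le_dpCost (f := F x) hB hq x (α x)
    have h2 := (hF.2 x).1
    nlinarith [sq_nonneg (‖α x‖ - C)]
  · refine (hα x 0).trans ?_
    have h1 := (hF.2 x).2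
    have h2 := (hg.2 x).2
    have h3 : 0 ≤ C ^ 2 / 2 * (1 + ‖x‖ ^ 2) := by positivity
    simp only [dpCost, norm_zero, inner_zero_left, add_zero]
    linarith

end Minimization

theorem valueBound_nonneg {C : ℝ} (hC : 0 ≤ C) (k : ℕ) : 0 ≤ valueBound C k := by
  induction k with
  | zero => exact hC
  | succ k ih => unfold valueBound; positivity

theorem valueBound_monotone {C : ℝ} (hC : 0 ≤ C) : Monotone (valueBound C) := by
  refine monotone_nat_of_le_succ fun k => ?_
  have h := valueBound_nonneg hC k
  have h1 : 0 ≤ C * valueBound C k := by positivity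
  rw [valueBound]
  nlinarith

theorem backwardValue_of_lt {T t : ℕ} {d : ℕ} (M : ℕ → Set (Measure (Euc d)))
    (F : ℕ → Euc d → ℝ) (p : ℕ → Euc d) (ht : t < T) (x : Euc d) :
    backwardValue T M F p (T - t) x = ⨅ a : Euc d, dpCost (p t) (F t x)
      (robustExp (M t) (backwardValue T M F p (T - (t + 1)))) x a := by
  have h1 : T - t = T - (t + 1) + 1 := by omega
  have h2 : T - (T - (t + 1) + 1) = t := by omega
  rw [h1, backwardValue, h2]

theorem isConvexQuadraticBounded_backwardValue {T d : ℕ} {C : ℝ} (hC : 0 ≤ C)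
    {M : ℕ → Set (Measure (Euc d))} {F : ℕ → Euc d → ℝ} {p : ℕ → Euc d}
    (hM : ∀ t < T, (M t).Nonempty)
    (hξ : ∀ t < T, ∀ ξ ∈ M t, IsProbabilityMeasure ξ ∧
      ∫⁻ y, (‖y‖₊ : ℝ≥0∞) ^ (2 : ℕ) ∂ξ ≤ ENNReal.ofReal C)
    (hF : ∀ t ≤ T, IsConvexQuadraticBounded C (F t)) (hp : ∀ t < T, ‖p t‖ ≤ C)
    {k : ℕ} (hk : k ≤ T) :
    IsConvexQuadraticBounded (valueBound C k) (backwardValue T M F p k) := by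
  induction k with
  | zero => exact hF T le_rfl
  | succ k ih =>
    have ht : T - (k + 1) < T := by omega
    exact (hF _ ht.le).iInf_dpCost
      ((ih (by omega)).robustExp (hM _ ht) (hξ _ ht) (valueBound_nonneg hC k) hC) (hp _ ht)

theorem IsConvexQuadraticBounded.exists_abs_le {d : ℕ} {B : ℝ} {v : Euc d → ℝ}
    (hv : IsConvexQuadraticBounded B v) (hB : 0 ≤ B) :
    ∃ K : ℝ, ∀ x, |v x| ≤ K * (1 + ‖x‖ ^ 2) := by
  refine ⟨B, fun x => abs_le.2 ⟨?_, (hv.2 x).2⟩⟩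
  have h1 := (hv.2 x).1
  have h2 : 0 ≤ B * ‖x‖ ^ 2 := by positivity
  linarith

/-- The equations of the system determine its solution. -/
theorem IsDPSolution.unique {T d : ℕ} {M : ℕ → Set (Measure (Euc d))} {F : ℕ → Euc d → ℝ}
    {p : ℕ → Euc d} {u ubar u' ubar' : ℕ → Euc d → ℝ} {α α' : ℕ → Euc d → Euc d}
    (h' : IsDPSolution T M F p u' ubar' α') (h : IsDPSolution T M F p u ubar α) :
    (∀ t ≤ T, ∀ x, u' t x = u t x) ∧
    (∀ t, 1 ≤ t → t ≤ T → ∀ x, ubar' t x = ubar t x) ∧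
    (∀ t < T, ∀ x, α' t x = α t x) := by
  obtain ⟨-, -, -, hT, hbar, hu, hα⟩ := h
  obtain ⟨-, -, -, hT', hbar', hu', hα'⟩ := h'
  have step : ∀ t < T, u' (t + 1) = u (t + 1) → ubar' (t + 1) = ubar (t + 1) := by
    intro t ht e
    funext x
    rw [hbar t ht, hbar' t ht, e]
  have eq_u : ∀ t ≤ T, u' t = u t := by
    intro t ht
    induction ht using Nat.decreasingInduction with
    | self => funext x; rw [hT, hT']
    | of_succ t ht ih =>
      funext x
      rw [hu t ht, hu' t ht, step t ht ih]
  refine ⟨fun t ht => congrFun (eq_u t ht), fun t h1 ht => ?_, fun t ht x => ?_⟩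
  · obtain ⟨s, rfl⟩ := Nat.exists_eq_add_of_le' h1
    exact congrFun (step s ht (eq_u _ ht))
  · refine (hα t ht x).2 _ ?_
    rw [← step t ht (eq_u _ ht)]
    exact (hα' t ht x).1

/-- Under the standing assumptions on the data `(M_t)`, `(F_t)`,
`(p_t)`, there exists a unique triple `(u, ū, α)` solving the dynamic programming
system, and there are constants `C_u, C_α > 0` depending only on `C` and `T` such that
each `u(t,·)` is convex with `−C_u ≤ u(t,x) ≤ C_u(1+|x|²)` and each `α_t` satisfies
`|α_t(x)| ≤ C_α(1+|x|)` and is `1`-Lipschitz. -/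
theorem dp_exists_unique (T : ℕ) (C : ℝ) (hT : 0 < T) (hC : 0 < C) :
    ∃ Cu Cα : ℝ, 0 < Cu ∧ 0 < Cα ∧
      ∀ (d : ℕ) (M : ℕ → Set (Measure (Euc d))) (F : ℕ → Euc d → ℝ) (p : ℕ → Euc d),
        (∀ t < T, (M t).Nonempty) →
        (∀ t < T, ∀ ξ ∈ M t, IsProbabilityMeasure ξ ∧
          ∫⁻ y, (‖y‖₊ : ℝ≥0∞) ^ (2 : ℕ) ∂ξ ≤ ENNReal.ofReal C) →
        (∀ t ≤ T, ConvexOn ℝ Set.univ (F t) ∧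
          ∀ x, -C ≤ F t x ∧ F t x ≤ C * (1 + ‖x‖ ^ 2)) →
        (∀ t < T, ‖p t‖ ≤ C) →
        ∃ u ubar : ℕ → Euc d → ℝ, ∃ α : ℕ → Euc d → Euc d,
          IsDPSolution T M F p u ubar α ∧
          (∀ u' ubar' : ℕ → Euc d → ℝ, ∀ α' : ℕ → Euc d → Euc d,
            IsDPSolution T M F p u' ubar' α' →
            (∀ t ≤ T, ∀ x, u' t x = u t x) ∧
            (∀ t, 1 ≤ t → t ≤ T → ∀ x, ubar' t x = ubar t x) ∧
            (∀ t < T, ∀ x, α' t x = α t x)) ∧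
          (∀ t ≤ T, ConvexOn ℝ Set.univ (u t) ∧
            ∀ x, -Cu ≤ u t x ∧ u t x ≤ Cu * (1 + ‖x‖ ^ 2)) ∧
          (∀ t < T, (∀ x, ‖α t x‖ ≤ Cα * (1 + ‖x‖)) ∧ LipschitzWith 1 (α t)) := by
  have hB : ∀ k, 0 ≤ valueBound C k := valueBound_nonneg hC.le
  have hBT : 0 < valueBound C T := hC.trans_le (valueBound_monotone hC.le (Nat.zero_le T))
  refine ⟨valueBound C T, 2 * C + 1 + 4 * ((2 + 2 * C) * valueBound C T), hBT, by positivity, ?_⟩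
  intro d M F p hM hξ hF hp
  set W := backwardValue T M F p with hW
  have hu : ∀ k ≤ T, IsConvexQuadraticBounded (valueBound C k) (W k) := fun k hk =>
    isConvexQuadraticBounded_backwardValue hC.le hM hξ hF hp hk
  have hubar : ∀ t < T, IsConvexQuadraticBounded ((2 + 2 * C) * valueBound C T)
      (robustExp (M t) (W (T - (t + 1)))) := fun t ht =>
    ((hu _ (Nat.sub_le _ _)).robustExp (hM t ht) (hξ t ht) (hB _) hC.le).mono
      (mul_le_mul_of_nonneg_left (valueBound_monotone hC.le (Nat.sub_le _ _)) (by positivity))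
  have hmin : ∀ t x, ∃ a, t < T → ∀ b,
      dpCost (p t) (F t x) (robustExp (M t) (W (T - (t + 1)))) x a ≤
        dpCost (p t) (F t x) (robustExp (M t) (W (T - (t + 1)))) x b := by
    intro t x
    by_cases ht : t < T
    · obtain ⟨a, ha⟩ := exists_dpCost_minimizer (f := F t x) (hubar t ht).continuous
        (fun x => ((hubar t ht).2 x).1) (hp t ht) x
      exact ⟨a, fun _ => ha⟩
    · exact ⟨0, fun h => absurd h ht⟩
  choose α hα using hmin
  have hLip : ∀ t < T, LipschitzWith 1 (α t) := fun t ht =>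
    LipschitzWith.of_dist_le_mul fun x z => by
      simpa [dist_eq_norm] using
        norm_sub_le_of_dpCost_minimizer (hubar t ht).1 (hα t x ht) (hα t z ht)
  have hgrowth : ∀ t < T, ∀ x,
      ‖α t x‖ ≤ (2 * C + 1 + 4 * ((2 + 2 * C) * valueBound C T)) * (1 + ‖x‖) := by
    intro t ht x
    have h0 := norm_le_of_dpCost_le_dpCost_zero (fun x => ((hubar t ht).2 x).1) (hp t ht)
      (hα t 0 ht 0)
    have h1 := ((hubar t ht).2 0).2
    have h2 := norm_sub_le_of_dpCost_minimizer (hubar t ht).1 (hα t x ht) (hα t 0 ht)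
    have h3 := norm_sub_norm_le (α t x) (α t 0)
    have h4 : 0 ≤ (2 * C + 4 * ((2 + 2 * C) * valueBound C T)) * ‖x‖ := by positivity
    rw [norm_zero] at h1
    rw [sub_zero] at h2
    linarith
  have hsol : IsDPSolution T M F p (fun t => W (T - t))
      (fun t => robustExp (M (t - 1)) (W (T - t))) α := by
    refine ⟨fun t _ => (hu _ (Nat.sub_le _ _)).exists_abs_le (hB _), fun t h1 ht => ?_,
      fun t ht => ⟨⟨_, hgrowth t ht⟩, hLip t ht⟩, fun x => ?_, fun t ht x => rfl,
      fun t ht x => backwardValue_of_lt M F p ht x, fun t ht x => ⟨hα t x ht, fun a ha => ?_⟩⟩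
    · obtain ⟨s, rfl⟩ := Nat.exists_eq_add_of_le' h1
      exact (hubar s ht).exists_abs_le (by positivity)
    · simp [hW, backwardValue]
    · have h := norm_sub_le_of_dpCost_minimizer (hubar t ht).1 ha (hα t x ht)
      rw [sub_self, norm_zero, norm_le_zero_iff, sub_eq_zero] at h
      exact h
  exact ⟨_, _, α, hsol, fun u' ubar' α' h' => h'.unique hsol,
    fun t _ => (hu _ (Nat.sub_le _ _)).mono (valueBound_monotone hC.le (Nat.sub_le _ _)),
    fun t ht => ⟨hgrowth t ht, hLip t ht⟩⟩
end
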